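/- arXiv:1412.8005 — 2 statements merged into one kernel-verified Lean document; each statement's English description precedes it below -/
import Mathlib

section
/- Let I be a finite set of intervals with pairwise distinct finishing times and let i₁, i₂, …, i_k ∈ I satisfy i_{t+1} = rc(i_t) for all t = 1, …, k−1. Then the intervals i₁, …, i_k are pairwise compatible; in other words, every path in the compatibility forest F(I) consists of pairwise compatible intervals. -/
/-- Two intervals (given as pairs (start, finish)) are compatible if one
finishes strictly before the other starts. -/
def Compatible (i j : ℝ × ℝ) : Prop := i.2 < j.1 ∨ j.2 < i.1

/-- `j` is the right compatible interval of `i` in `I`: the ≼-least element of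
`I` compatible with `i` and strictly after `i` in the ordering by finishing time. -/
def IsRC (I : Finset (ℝ × ℝ)) (i j : ℝ × ℝ) : Prop :=
  j ∈ I ∧ i.2 < j.2 ∧ Compatible i j ∧
    ∀ k ∈ I, i.2 < k.2 → Compatible i k → j.2 ≤ k.2

/-- The right compatible interval of `i` starts after `i` finishes. -/
theorem IsRC.finish_lt_start {I : Finset (ℝ × ℝ)} {i j : ℝ × ℝ} (h : IsRC I i j)
    (hi : i.1 < i.2) : i.2 < j.1 := by
  obtain ⟨-, hlt, hc, -⟩ := h
  exact hc.resolve_right fun hji => lt_irrefl _ (hji.trans (hi.trans hlt))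

/-- Every path in the compatibility forest (each vertex followed by its right
compatible interval) consists of pairwise compatible intervals. -/
theorem path_pairwise_compatible (I : Finset (ℝ × ℝ))
    (hval : ∀ i ∈ I, i.1 < i.2)
    (hdist : ∀ i ∈ I, ∀ j ∈ I, i.2 = j.2 → i = j)
    (k : ℕ) (v : ℕ → ℝ × ℝ)
    (hmem : ∀ t < k, v t ∈ I)
    (hstep : ∀ t, t + 1 < k → IsRC I (v t) (v (t + 1))) :
    ∀ s < k, ∀ t < k, s ≠ t → Compatible (v s) (v t) := by
  have finish_lt_start : ∀ s t, s < t → t < k → (v s).2 < (v t).1 := by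
    intro s t hst
    induction t, hst using Nat.le_induction with
    | base => exact fun ht => (hstep s ht).finish_lt_start (hval _ (hmem s (by omega)))
    | succ t _ ih =>
      intro ht
      have hv := hval _ (hmem t (by omega))
      exact ((ih (by omega)).trans hv).trans ((hstep t ht).finish_lt_start hv)
  intro s hs t ht hne
  exact hne.lt_or_gt.imp (finish_lt_start s t · ht) (finish_lt_start t s · hs)
end

section
/- Let I be a finite nonempty monotonic set of intervals with pairwise distinct finishing times, let m be the ≼-least interval of I, and let J be the greedy optimal set of I. Then for every interval x on the ancestor chain of m in the linearised tree L(I) such that rc(x) exists, there is an interval y ∈ J with rc(y) = rc(x) (i.e., y ∈ [x]). -/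
/-- A set of intervals is monotonic if no interval properly contains another. -/
def Monotonic (I : Finset (ℝ × ℝ)) : Prop :=
  ∀ i ∈ I, ∀ j ∈ I, i ≠ j → ¬(i.1 ≤ j.1 ∧ j.2 ≤ i.2)

/-- Equivalence edge of the linearised tree: `i ∼ j` (same right compatible
interval) and `i` is the ≼-predecessor of `j` in `I`. -/
def ESim (I : Finset (ℝ × ℝ)) (i j : ℝ × ℝ) : Prop :=
  i ∈ I ∧ j ∈ I ∧ (∃ r, IsRC I i r ∧ IsRC I j r) ∧
    i.2 < j.2 ∧ ∀ k ∈ I, i.2 < k.2 → j.2 ≤ k.2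

/-- Compatibility edge of the linearised tree: `rc(i)` exists, `i` is the
≼-greatest element of its equivalence class `[i]`, and `j = rc(i)`. -/
def EC (I : Finset (ℝ × ℝ)) (i j : ℝ × ℝ) : Prop :=
  i ∈ I ∧ IsRC I i j ∧ ∀ k ∈ I, IsRC I k j → k.2 ≤ i.2

/-- An edge of the linearised tree `L(I)` (union of the two edge sets). -/
def LTEdge (I : Finset (ℝ × ℝ)) (i j : ℝ × ℝ) : Prop :=
  ESim I i j ∨ EC I i j

/-- `m` is the ≼-least interval of `I` (ordering by finishing time). -/
def IsLeastInterval (I : Finset (ℝ × ℝ)) (m : ℝ × ℝ) : Prop :=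
  m ∈ I ∧ ∀ j ∈ I, m.2 ≤ j.2

/-- Membership in the greedy optimal set of `I`. -/
inductive InGreedy (I : Finset (ℝ × ℝ)) : ℝ × ℝ → Prop
  | base (m : ℝ × ℝ) : IsLeastInterval I m → InGreedy I m
  | step (i j : ℝ × ℝ) : InGreedy I i → IsRC I i j → InGreedy I j

/-- `x` lies on the ancestor chain of `m` in the linearised tree `L(I)`:
`x` is `m` or an iterated parent of `m`. -/
def OnAncestorChain (I : Finset (ℝ × ℝ)) (m x : ℝ × ℝ) : Prop :=
  Relation.ReflTransGen (LTEdge I) m x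

/-- The right compatible interval is unique when finishing times are distinct. -/
theorem IsRC.unique {I : Finset (ℝ × ℝ)}
    (hdist : ∀ i ∈ I, ∀ j ∈ I, i.2 = j.2 → i = j) {i r s : ℝ × ℝ}
    (hr : IsRC I i r) (hs : IsRC I i s) : r = s :=
  hdist r hr.1 s hs.1 <| le_antisymm
    (hr.2.2.2 s hs.1 hs.2.1 hs.2.2.1) (hs.2.2.2 r hr.1 hr.2.1 hr.2.2.1)

/-- For a nonempty monotonic set `I` with ≼-least interval `m`: every interval
`x` on the ancestor chain of `m` in the linearised tree `L(I)` whose right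
compatible interval exists is equivalent to some interval of the greedy optimal
set (they have the same right compatible interval). -/
theorem ancestor_chain_equivalent_to_greedy (I : Finset (ℝ × ℝ)) (hne : I.Nonempty)
    (hval : ∀ i ∈ I, i.1 < i.2)
    (hdist : ∀ i ∈ I, ∀ j ∈ I, i.2 = j.2 → i = j)
    (hmono : Monotonic I)
    (m : ℝ × ℝ) (hm : IsLeastInterval I m) :
    ∀ x : ℝ × ℝ, OnAncestorChain I m x →
      ∀ r : ℝ × ℝ, IsRC I x r → ∃ y : ℝ × ℝ, InGreedy I y ∧ IsRC I y r := by
  intro x hx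
  induction hx with
  | refl => exact fun r hr => ⟨m, .base m hm, hr⟩
  | @tail x z _ hedge ih =>
    intro r hr
    rcases hedge with ⟨_, _, ⟨s, hxs, hzs⟩, _⟩ | ⟨_, hxz, _⟩
    · obtain rfl := hr.unique hdist hzs
      exact ih r hxs
    · obtain ⟨y, hy, hyz⟩ := ih z hxz
      exact ⟨z, .step y z hy hyz, hr⟩
end
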